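/- arXiv:2102.11059 — 5 statements merged into one kernel-verified Lean document; each statement's English description precedes it below -/
import Mathlib

section
/- Let X be a non-Archimedean strictly convex normed space over a normed field K. Then every vector x ∈ X satisfies 3·x = 0 (i.e. x + x + x = 0). -/
/-- In a non-Archimedean strictly convex normed space `X` over a
normed field `K`, every vector `x` satisfies `3 • x = 0`, i.e. `x + x + x = 0`. -/
theorem strictly_convex_three_torsion
    (K : Type*) [NormedField K] (X : Type*) [NormedAddCommGroup X] [NormedSpace K X]
    (hNA : ∀ x y : X, ‖x + y‖ ≤ max ‖x‖ ‖y‖)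
    (hSC1 : ‖(2 : K)‖ = 1)
    (hSC2 : ∀ x y : X, ‖x‖ = ‖y‖ → ‖y‖ = ‖x + y‖ → x = y) :
    ∀ x : X, x + x + x = 0 := by
  intro x
  have hnorm : ‖-((2 : K) • x)‖ = ‖x‖ := by rw [norm_neg, norm_smul, hSC1, one_mul]
  have hsum : x + -((2 : K) • x) = -x := by rw [two_smul]; abel
  have hx : x = -((2 : K) • x) :=
    hSC2 x _ hnorm.symm (by rw [hsum, hnorm, norm_neg])
  rw [two_smul] at hx
  rw [add_assoc]
  exact eq_neg_iff_add_eq_zero.mp hx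
end

section
/- Let X be a non-Archimedean strictly convex normed space over a normed field K. If X contains a nonzero vector, then 3 = 0 in K, i.e. the field K has characteristic 3. -/
/-- If a non-Archimedean strictly convex normed space `X` over a
normed field `K` contains a nonzero vector, then `3 = 0` in `K`. -/
theorem strictly_convex_char_three
    (K : Type*) [NormedField K] (X : Type*) [NormedAddCommGroup X] [NormedSpace K X]
    (hNA : ∀ x y : X, ‖x + y‖ ≤ max ‖x‖ ‖y‖)
    (hSC1 : ‖(2 : K)‖ = 1)
    (hSC2 : ∀ x y : X, ‖x‖ = ‖y‖ → ‖y‖ = ‖x + y‖ → x = y)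
    (hX : ∃ x : X, x ≠ 0) :
    (3 : K) = 0 := by
  obtain ⟨x, hx⟩ := hX
  have h₁ : ‖(-2 : K) • x‖ = ‖x‖ := by rw [norm_smul, norm_neg, hSC1, one_mul]
  have h₂ : x + (-2 : K) • x = -x := by module
  have h₃ : x = (-2 : K) • x := hSC2 x _ h₁.symm (by rw [h₁, h₂, norm_neg])
  have h₄ : (3 : K) • x = 0 := by
    calc (3 : K) • x = x - (-2 : K) • x := by module
      _ = 0 := sub_eq_zero.mpr h₃
  exact (smul_eq_zero.mp h₄).resolve_right hx
end

section
/- Let X be a non-Archimedean strictly convex normed space over a normed field K. Then for any two nonzero vectors x, y ∈ X, either y = x or y = -x. (Consequently, a nonzero strictly convex space X consists exactly of the three vectors 0, x, -x for any nonzero x, and is linearly isometric to a one-dimensional space over ℤ/3ℤ.) -/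
/-- In a non-Archimedean strictly convex normed space, any two
nonzero vectors `x, y` satisfy `y = x` or `y = -x`. -/
theorem strictly_convex_nonzero_eq_or_neg
    (K : Type*) [NormedField K] (X : Type*) [NormedAddCommGroup X] [NormedSpace K X]
    (hNA : ∀ x y : X, ‖x + y‖ ≤ max ‖x‖ ‖y‖)
    (hSC1 : ‖(2 : K)‖ = 1)
    (hSC2 : ∀ x y : X, ‖x‖ = ‖y‖ → ‖y‖ = ‖x + y‖ → x = y) :
    ∀ x y : X, x ≠ 0 → y ≠ 0 → y = x ∨ y = -x := by
  have norm_double (x : X) : ‖x + x‖ = ‖x‖ := by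
    rw [← two_smul K x, norm_smul, hSC1, one_mul]
  have eq_or_neg_of_norm_eq (x y : X) (h : ‖x‖ = ‖y‖) : y = x ∨ y = -x := by
    have hle : ‖x + y‖ ≤ ‖x‖ := by simpa [h] using hNA x y
    rcases hle.eq_or_lt with heq | hlt
    · exact Or.inl (hSC2 x y h (by rw [heq, h])).symm
    · right
      have hsub : ‖x + -y‖ ≤ ‖x‖ := by simpa [h] using hNA x (-y)
      have hmax := hNA (x + y) (x + -y)
      rw [show x + y + (x + -y) = x + x by abel, norm_double] at hmax
      have hge : ‖x‖ ≤ ‖x + -y‖ := (le_max_iff.mp hmax).resolve_left hlt.not_ge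
      rw [hSC2 x (-y) (by rwa [norm_neg]) (by rw [norm_neg, ← h]; exact hge.antisymm hsub),
        neg_neg]
  have not_norm_lt (x y : X) (hy : y ≠ 0) : ¬ ‖y‖ < ‖x‖ := by
    intro hlt
    have hle : ‖x + y‖ ≤ ‖x‖ := by simpa [hlt.le] using hNA x y
    have hmax := hNA (x + y) (-y)
    rw [add_neg_cancel_right, norm_neg] at hmax
    have hge : ‖x‖ ≤ ‖x + y‖ := (le_max_iff.mp hmax).resolve_right hlt.not_ge
    rcases eq_or_neg_of_norm_eq x (x + y) (hge.antisymm hle) with h | h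
    · exact hy (by simpa using h)
    · have hy' : y = -(x + x) := by
        rw [← add_right_inj x, h]
        abel
      rw [hy', norm_neg, norm_double] at hlt
      exact hlt.false
  intro x y hx hy
  exact eq_or_neg_of_norm_eq x y
    (le_antisymm (not_lt.mp (not_norm_lt x y hy)) (not_lt.mp (not_norm_lt y x hx)))
end

section
/- Let X be a nonzero non-Archimedean strictly convex normed space over a normed field K. Then X has exactly three elements. -/
section Ultrametric

variable {X : Type*} [NormedAddCommGroup X]

theorem norm_add_eq_left_of_norm_lt (hNA : ∀ x y : X, ‖x + y‖ ≤ max ‖x‖ ‖y‖) {x y : X}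
    (h : ‖y‖ < ‖x‖) : ‖x + y‖ = ‖x‖ := by
  have h₁ := hNA x y
  have h₂ := hNA (x + y) (-y)
  rw [add_neg_cancel_right, norm_neg] at h₂
  rw [max_eq_left h.le] at h₁
  exact h₁.antisymm ((le_max_iff.mp h₂).resolve_right h.not_ge)

theorem eq_zero_of_norm_lt_of_strictly_convex (hNA : ∀ x y : X, ‖x + y‖ ≤ max ‖x‖ ‖y‖)
    (h_two : ∀ x : X, ‖x + x‖ = ‖x‖)
    (hSC2 : ∀ x y : X, ‖x‖ = ‖y‖ → ‖y‖ = ‖x + y‖ → x = y) {x y : X}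
    (h : ‖y‖ < ‖x‖) : y = 0 := by
  have h₁ := norm_add_eq_left_of_norm_lt hNA h
  have h₂ : ‖x + x + y‖ = ‖x + x‖ := norm_add_eq_left_of_norm_lt hNA (by rwa [h_two])
  have h₃ := hSC2 x (x + y) h₁.symm (by rw [← add_assoc, h₂, h_two, h₁])
  simpa using h₃

theorem eq_or_eq_neg_of_strictly_convex (hNA : ∀ x y : X, ‖x + y‖ ≤ max ‖x‖ ‖y‖)
    (h_two : ∀ x : X, ‖x + x‖ = ‖x‖)
    (hSC2 : ∀ x y : X, ‖x‖ = ‖y‖ → ‖y‖ = ‖x + y‖ → x = y) {x y : X}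
    (h : ‖x‖ = ‖y‖) : y = x ∨ y = -x := by
  have h_sum := hNA (x + y) (x + -y)
  rw [add_add_add_comm, add_neg_cancel, add_zero, h_two] at h_sum
  rcases le_max_iff.mp h_sum with h₁ | h₁
  · have h₂ := hNA x y
    rw [h, max_self] at h₂
    exact .inl (hSC2 x y h ((h ▸ h₁).antisymm h₂)).symm
  · have h₂ := hNA x (-y)
    rw [norm_neg, h, max_self] at h₂
    refine .inr ?_
    rw [hSC2 x (-y) (by rwa [norm_neg]) (by rw [norm_neg]; exact (h ▸ h₁).antisymm h₂), neg_neg]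

end Ultrametric

/-- A nonzero non-Archimedean strictly convex normed space has
exactly three elements. -/
theorem strictly_convex_card_three
    (K : Type*) [NormedField K] (X : Type*) [NormedAddCommGroup X] [NormedSpace K X]
    (hNA : ∀ x y : X, ‖x + y‖ ≤ max ‖x‖ ‖y‖)
    (hSC1 : ‖(2 : K)‖ = 1)
    (hSC2 : ∀ x y : X, ‖x‖ = ‖y‖ → ‖y‖ = ‖x + y‖ → x = y)
    (hX : ∃ x : X, x ≠ 0) :
    Nat.card X = 3 := by
  have h_two (x : X) : ‖x + x‖ = ‖x‖ := by
    rw [← two_smul K x, norm_smul, hSC1, one_mul]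
  obtain ⟨x, hx⟩ := hX
  have hx_neg : x ≠ -x := by
    intro h
    have h₁ := h_two x
    rw [add_eq_zero_iff_eq_neg.mpr h, norm_zero] at h₁
    exact hx (norm_eq_zero.mp h₁.symm)
  rw [← Set.ncard_univ, Set.ncard_eq_three]
  refine ⟨0, x, -x, hx.symm, (neg_ne_zero.mpr hx).symm, hx_neg, ?_⟩
  refine (Set.eq_univ_of_forall fun y => ?_).symm
  rcases lt_trichotomy ‖x‖ ‖y‖ with h | h | h
  · exact absurd (eq_zero_of_norm_lt_of_strictly_convex hNA h_two hSC2 h) hx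
  · exact .inr (eq_or_eq_neg_of_strictly_convex hNA h_two hSC2 h)
  · exact .inl (eq_zero_of_norm_lt_of_strictly_convex hNA h_two hSC2 h)
end

section
/- Let X be a non-Archimedean strictly convex normed space over a normed field K. Then any two nonzero vectors of X have the same norm; that is, there exists a ∈ (0,∞) with ‖x‖ = a for every nonzero x ∈ X (provided X is nonzero). -/
/-- In an ultrametric strictly convex space no nonzero vector is strictly shorter than another:
if `‖x‖ < ‖y‖`, then `x + y` and `y` both have norm `‖y‖`, as does their sum `x + 2 • y`. -/
theorem eq_zero_of_norm_lt_of_strictly_convex_s4 {K X : Type*} [NormedField K]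
    [NormedAddCommGroup X] [NormedSpace K X] [IsUltrametricDist X] (h2 : ‖(2 : K)‖ = 1)
    (hSC : ∀ x y : X, ‖x‖ = ‖y‖ → ‖y‖ = ‖x + y‖ → x = y) {x y : X} (h : ‖x‖ < ‖y‖) :
    x = 0 := by
  have norm_two_smul : ‖(2 : K) • y‖ = ‖y‖ := by rw [norm_smul, h2, one_mul]
  have norm_add {z : X} (hz : ‖z‖ = ‖y‖) : ‖x + z‖ = ‖y‖ := by
    rw [IsUltrametricDist.norm_add_eq_max_of_norm_ne_norm (by rw [hz]; exact h.ne), hz,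
      max_eq_right h.le]
  refine add_eq_right.mp (hSC (x + y) y (norm_add rfl) ?_)
  rw [add_assoc, ← two_smul K y, norm_add norm_two_smul]

/-- In a nonzero non-Archimedean strictly convex normed space, all
nonzero vectors have the same norm: there is `a ∈ (0, ∞)` with `‖x‖ = a` for
every nonzero `x`. -/
theorem strictly_convex_norm_const
    (K : Type*) [NormedField K] (X : Type*) [NormedAddCommGroup X] [NormedSpace K X]
    (hNA : ∀ x y : X, ‖x + y‖ ≤ max ‖x‖ ‖y‖)
    (hSC1 : ‖(2 : K)‖ = 1)
    (hSC2 : ∀ x y : X, ‖x‖ = ‖y‖ → ‖y‖ = ‖x + y‖ → x = y)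
    (hX : ∃ x : X, x ≠ 0) :
    ∃ a : ℝ, 0 < a ∧ ∀ x : X, x ≠ 0 → ‖x‖ = a := by
  have : IsUltrametricDist X :=
    IsUltrametricDist.isUltrametricDist_of_forall_norm_add_le_max_norm hNA
  obtain ⟨x₀, hx₀⟩ := hX
  refine ⟨‖x₀‖, norm_pos_iff.mpr hx₀, fun x hx => le_antisymm ?_ ?_⟩
  · exact not_lt.mp fun h => hx₀ (eq_zero_of_norm_lt_of_strictly_convex_s4 hSC1 hSC2 h)
  · exact not_lt.mp fun h => hx (eq_zero_of_norm_lt_of_strictly_convex_s4 hSC1 hSC2 h)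
end
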